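/- Let k ≥ 3 and let P be a perfect matching of K_{2k}. Then the number of perfect matchings Q of K_{2k} having exactly one edge in common with P such that the graph on {1,…,2k} with edge set P ∪ Q has exactly two connected components equals k·(2k−4)!!. -/

import Mathlib

/-- A perfect matching of the complete graph on `Fin n`: a finite set of non-loop edges such
that every vertex lies on exactly one of them. -/
def IsPM {n : ℕ} (P : Finset (Sym2 (Fin n))) : Prop :=
  (∀ e ∈ P, ¬ e.IsDiag) ∧ ∀ v : Fin n, ∃! e, e ∈ P ∧ v ∈ e

/-- `q` is an involution moving exactly the points of `S`, and `S` has no proper nonempty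
subset closed under both `p` and `q`. -/
structure IsTransitiveInvolution {V : Type*} (p : V → V) (S : Finset V) (q : V → V) : Prop where
  invol : ∀ x, q (q x) = x
  fixed_iff : ∀ x, q x = x ↔ x ∉ S
  eq_of_closed : ∀ T ⊆ S, T.Nonempty → (∀ x ∈ T, p x ∈ T ∧ q x ∈ T) → T = S

namespace IsTransitiveInvolution

variable {V : Type*} {p q : V → V} {S : Finset V} {a b c : V}

theorem apply_mem (h : IsTransitiveInvolution p S q) {x : V} (hx : x ∈ S) : q x ∈ S := by
  have := h.fixed_iff (q x)
  have := h.fixed_iff x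
  have := h.invol x
  grind

variable [DecidableEq V]

/-- Remove `a` and `b` from the involution `q` and join their former partners. -/
def contract (a b : V) (q : V → V) (x : V) : V :=
  if x = a then a else if x = b then b else
    if x = q a then q b else if x = q b then q a else q x

/-- Insert `a` and `b` into the involution `q` by breaking up the pair `c`, `q c`. -/
def expand (a b c : V) (q : V → V) (x : V) : V :=
  if x = a then c else if x = c then a else
    if x = b then q c else if x = q c then b else q x

theorem apply_ne (h : IsTransitiveInvolution p S q) (hp : ∀ x ∈ S, p (p x) = x) {x : V}
    (hx : x ∈ S) (hpx : p x ∈ S) (hS : 2 < S.card) : q x ≠ p x := by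
  intro hq
  have hT := h.eq_of_closed {x, p x} (by grind) (by simp) (by
    have := h.invol x
    have := hp x hx
    grind)
  have := Finset.card_le_two (a := x) (b := p x)
  grind

theorem contract_self (hp : ∀ x, p (p x) = x) (hS : ∀ x ∈ S, p x ∈ S ∧ p x ≠ x)
    (ha : a ∈ S) (hb : p a = b) (hc : 2 < S.card) (h : IsTransitiveInvolution p S q) :
    IsTransitiveInvolution p (S \ {a, b}) (contract a b q) := by
  have hab := h.apply_ne (fun x _ => hp x) ha (hS a ha).1 hc
  have hqa := h.apply_mem ha
  have hbS : b ∈ S := hb ▸ (hS a ha).1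
  have hqb := h.apply_mem hbS
  have hi := h.invol
  have hf := h.fixed_iff
  have hpb : p b = a := by rw [← hb, hp]
  refine ⟨?_, ?_, ?_⟩
  · intro x
    have := hi x
    have := hi a
    have := hi b
    unfold contract
    grind
  · intro x
    have := hi x
    have := hi a
    have := hi b
    have := hf x
    have := hf a
    have := hf b
    unfold contract
    grind
  · intro T hT hne hcl
    have hia := hi a
    have hib := hi b
    have hfa := hf a
    have hfb := hf b
    have hTa : a ∉ T := by grind
    have hTb : b ∉ T := by grind
    have hcc := fun x hx => (hcl x hx).2
    have hq1 : q a ∈ T → q b ∈ T := fun hx => by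
      have := hcc _ hx
      unfold contract at this
      grind
    have hq2 : q b ∈ T → q a ∈ T := fun hx => by
      have := hcc _ hx
      unfold contract at this
      grind
    have hq3 : ∀ x ∈ T, x = q a ∨ x = q b ∨ q x ∈ T := fun x hx => by
      have := hcc _ hx
      unfold contract at this
      grind
    have hpT : ∀ x ∈ T, p x ∈ T := fun x hx => (hcl x hx).1
    clear hcc hcl hi hf hS hp
    by_cases hcT : q a ∈ T
    · have hTS := h.eq_of_closed (T ∪ {a, b}) (by grind) (by simp) (by
        intro x hx
        have := hq3 x
        have := hpT x
        simp only [Finset.mem_union, Finset.mem_insert, Finset.mem_singleton] at hx ⊢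
        clear hq3 hpT h hT hne
        grind)
      rw [← hTS, Finset.union_sdiff_cancel_right (by simp [hTa, hTb])]
    · have := h.eq_of_closed T (by grind) hne (by
        intro x hx
        have := hq3 x hx
        exact ⟨hpT x hx, by grind⟩)
      grind

theorem expand_self (hp : ∀ x, p (p x) = x) (hS : ∀ x ∈ S, p x ∈ S ∧ p x ≠ x)
    (ha : a ∈ S) (hb : p a = b) (hc : c ∈ S \ {a, b})
    (h : IsTransitiveInvolution p (S \ {a, b}) q) :
    IsTransitiveInvolution p S (expand a b c q) := by
  have hqc := h.apply_mem hc
  have hbS : b ∈ S := hb ▸ (hS a ha).1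
  have hab : a ≠ b := hb ▸ (hS a ha).2.symm
  have hi := h.invol
  have hf := h.fixed_iff
  have hpb : p b = a := by rw [← hb, hp]
  have hic := hi c
  have hfc := hf c
  have hfa := hf a
  have hfb := hf b
  refine ⟨?_, ?_, ?_⟩
  · intro x
    have := hi x
    have := hf x
    unfold expand
    grind
  · intro x
    have := hi x
    have := hf x
    unfold expand
    grind
  · intro T hT hne hcl
    have hcc := fun x hx => (hcl x hx).2
    have ea : expand a b c q a = c := by unfold expand; grind
    have eb : expand a b c q b = q c := by unfold expand; grind
    have ec : expand a b c q c = a := by unfold expand; grind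
    have ed : expand a b c q (q c) = b := by unfold expand; grind
    have ex : ∀ x, x ≠ a → x ≠ b → x ≠ c → x ≠ q c → expand a b c q x = q x := by
      intro x; unfold expand; grind
    have hpa : a ∈ T → b ∈ T := fun hx => hb ▸ (hcl a hx).1
    have hpb' : b ∈ T → a ∈ T := fun hx => hpb ▸ (hcl b hx).1
    have hca : a ∈ T → c ∈ T := fun hx => ea ▸ hcc a hx
    have hqb : b ∈ T → q c ∈ T := fun hx => eb ▸ hcc b hx
    have hac : c ∈ T → a ∈ T := fun hx => ec ▸ hcc c hx
    have hbq : q c ∈ T → b ∈ T := fun hx => ed ▸ hcc (q c) hx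
    have hcx : ∀ x ∈ T, x = a ∨ x = b ∨ x = c ∨ x = q c ∨ q x ∈ T := fun x hx => by
      have := hcc x hx
      have := ex x
      grind
    have hpx : ∀ x ∈ T, p x ∈ T ∧ (x = a ∨ x = b ∨ p x ≠ a ∧ p x ≠ b) := fun x hx =>
      ⟨(hcl x hx).1, by have := hp x; grind⟩
    clear hcc hcl ea eb ec ed ex
    by_cases haT : a ∈ T
    · have := h.eq_of_closed (T \ {a, b}) (by grind) ⟨c, by grind⟩ (by
        intro x hx
        have := hcx x
        have := hpx x
        have := hi x
        simp only [Finset.mem_sdiff, Finset.mem_insert, Finset.mem_singleton] at hx hqc hc ⊢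
        clear hcx hpx hS hp hi hf hT hne h
        grind)
      grind
    · have hbT : b ∉ T := by grind
      have := h.eq_of_closed T (by grind) hne (by
        intro x hx
        have := hcx x
        have := hpx x
        clear hcx hpx hS hp hi hf
        grind)
      grind

theorem expand_contract (hp : ∀ x, p (p x) = x) (hS : ∀ x ∈ S, p x ∈ S ∧ p x ≠ x)
    (ha : a ∈ S) (hb : p a = b) (hc : 2 < S.card) (h : IsTransitiveInvolution p S q) :
    expand a b (q a) (contract a b q) = q := by
  have hab := h.apply_ne (fun x _ => hp x) ha (hS a ha).1 hc
  have hia := h.invol a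
  have hib := h.invol b
  have hfa := h.fixed_iff a
  have hfb := h.fixed_iff b
  funext x
  have := h.invol x
  unfold expand contract
  grind

theorem contract_expand (hS : ∀ x ∈ S, p x ∈ S ∧ p x ≠ x)
    (ha : a ∈ S) (hb : p a = b) (hc : c ∈ S \ {a, b})
    (h : IsTransitiveInvolution p (S \ {a, b}) q) :
    contract a b (expand a b c q) = q := by
  have hqc := h.apply_mem hc
  have hab : a ≠ b := hb ▸ (hS a ha).2.symm
  have hic := h.invol c
  have hfc := h.fixed_iff c
  have hfa := h.fixed_iff a
  have hfb := h.fixed_iff b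
  funext x
  have := h.invol x
  unfold expand contract
  grind

/-- Contracting the pair `a`, `p a`, while remembering the partner of `a`, is a bijection. -/
def contractEquiv (hp : ∀ x, p (p x) = x) (hS : ∀ x ∈ S, p x ∈ S ∧ p x ≠ x)
    (ha : a ∈ S) (hb : p a = b) (hc : 2 < S.card) :
    {q // IsTransitiveInvolution p S q} ≃
      (S \ {a, b} : Finset V) × {q // IsTransitiveInvolution p (S \ {a, b}) q} where
  toFun q := ⟨⟨q.1 a, by
      have := q.2.apply_ne (fun x _ => hp x) ha (hS a ha).1 hc
      have := q.2.apply_mem ha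
      have := q.2.fixed_iff a
      grind⟩, ⟨_, q.2.contract_self hp hS ha hb hc⟩⟩
  invFun x := ⟨_, x.2.2.expand_self hp hS ha hb x.1.2⟩
  left_inv q := Subtype.ext (q.2.expand_contract hp hS ha hb hc)
  right_inv x := Prod.ext (Subtype.ext (by simp [expand]))
    (Subtype.ext (x.2.2.contract_expand hS ha hb x.1.2))

theorem swap_self (hab : a ≠ b) (hb : p a = b) (hpb : p b = a) :
    IsTransitiveInvolution p {a, b} (Equiv.swap a b) := by
  refine ⟨by simp, fun x => ?_, fun T hT hne hcl => ?_⟩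
  · grind
  · obtain ⟨x, hx⟩ := hne
    have := hcl x hx
    grind

theorem eq_swap (h : IsTransitiveInvolution p {a, b} q) : q = Equiv.swap a b := by
  funext x
  have := h.fixed_iff
  have := fun x => h.apply_mem (x := x)
  grind

theorem natCard (hp : ∀ x, p (p x) = x) (m : ℕ) :
    ∀ S : Finset V, (∀ x ∈ S, p x ∈ S ∧ p x ≠ x) → S.card = 2 * m + 2 →
      Nat.card {q // IsTransitiveInvolution p S q} = Nat.doubleFactorial (2 * m) := by
  induction m with
  | zero =>
    intro S hS hcard
    obtain ⟨a, ha⟩ : S.Nonempty := Finset.card_pos.1 (by lia)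
    have hpair : {a, p a} = S := Finset.eq_of_subset_of_card_le (by grind)
      (by rw [hcard, Finset.card_pair (hS a ha).2.symm])
    subst hpair
    rw [Nat.card_eq_one_iff_unique.2
      ⟨⟨fun q r => Subtype.ext (q.2.eq_swap.trans r.2.eq_swap.symm)⟩,
        ⟨_, swap_self (hS a ha).2.symm rfl (hp a)⟩⟩]
    simp
  | succ m ih =>
    intro S hS hcard
    obtain ⟨a, ha⟩ : S.Nonempty := Finset.card_pos.1 (by lia)
    have hsub : ({a, p a} : Finset V) ⊆ S := by grind
    have hrest : (S \ {a, p a}).card = 2 * m + 2 := by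
      rw [Finset.card_sdiff_of_subset hsub, Finset.card_pair (hS a ha).2.symm]
      lia
    rw [Nat.card_congr (contractEquiv hp hS ha rfl (by lia)), Nat.card_prod,
      ih (S \ {a, p a}) (by grind) hrest, Nat.card_eq_fintype_card, Fintype.card_coe, hrest,
      show 2 * (m + 1) = 2 * m + 2 by ring, Nat.doubleFactorial_add_two]

end IsTransitiveInvolution

section Matching

variable {V : Type*} [Fintype V] [DecidableEq V]

/-- The set of edges `{x, q x}`. -/
def pairEdges (q : V → V) : Finset (Sym2 V) := Finset.univ.image fun x => s(x, q x)

theorem mk_mem_pairEdges {q : V → V} (hq : ∀ x, q (q x) = x) {x y : V} :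
    s(x, y) ∈ pairEdges q ↔ q x = y := by
  simp only [pairEdges, Finset.mem_image, Finset.mem_univ, true_and, Sym2.eq_iff]
  grind

theorem pairEdges_injective {q r : V → V} (hq : ∀ x, q (q x) = x) (hr : ∀ x, r (r x) = x)
    (h : pairEdges q = pairEdges r) : q = r := by
  funext x
  have : s(x, r x) ∈ pairEdges q := h ▸ (mk_mem_pairEdges hr).2 rfl
  exact (mk_mem_pairEdges hq).1 this

theorem isPM_pairEdges {n : ℕ} {q : Fin n → Fin n} (hq : ∀ x, q (q x) = x)
    (hne : ∀ x, q x ≠ x) : IsPM (pairEdges q) := by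
  refine ⟨fun e he => ?_, fun v => ⟨s(v, q v), ⟨(mk_mem_pairEdges hq).2 rfl, by simp⟩, ?_⟩⟩
  · induction e with | _ x y
    rw [mk_mem_pairEdges hq] at he
    grind [Sym2.mk_isDiag_iff]
  · rintro e ⟨he, hv⟩
    obtain ⟨y, rfl⟩ := Sym2.mem_iff_exists.1 hv
    rw [(mk_mem_pairEdges hq).1 he]

theorem IsPM.exists_eq_pairEdges {n : ℕ} {Q : Finset (Sym2 (Fin n))} (hQ : IsPM Q) :
    ∃ q : Fin n → Fin n, (∀ x, q (q x) = x) ∧ (∀ x, q x ≠ x) ∧ Q = pairEdges q := by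
  have hex : ∀ v, ∃ w, s(v, w) ∈ Q := fun v => by
    obtain ⟨e, ⟨he, hv⟩, -⟩ := hQ.2 v
    obtain ⟨y, rfl⟩ := Sym2.mem_iff_exists.1 hv
    exact ⟨y, he⟩
  choose q hq using hex
  have huniq : ∀ x y, s(x, y) ∈ Q → q x = y := fun x y hxy => by
    have := (hQ.2 x).unique ⟨hq x, by simp⟩ ⟨hxy, by simp⟩
    exact Sym2.congr_right.1 this
  have hinv : ∀ x, q (q x) = x := fun x => huniq _ _ (by rw [Sym2.eq_swap]; exact hq x)
  refine ⟨q, hinv, fun x hx => hQ.1 _ (hq x) (by simp [hx]), ?_⟩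
  ext e
  induction e with | _ x y
  rw [mk_mem_pairEdges hinv]
  exact ⟨huniq x y, fun h => h ▸ hq x⟩

theorem IsPM.two_mul_card {n : ℕ} {P : Finset (Sym2 (Fin n))} (hP : IsPM P) :
    2 * P.card = n := by
  have hcount := Finset.sum_card_bipartiteAbove_eq_sum_card_bipartiteBelow
    (s := (Finset.univ : Finset (Fin n))) (t := P) (fun v e => v ∈ e)
  rw [Finset.sum_congr rfl (g := fun _ => 1), Finset.sum_congr (s₁ := P) rfl (g := fun _ => 2)]
    at hcount
  · simpa [mul_comm] using hcount.symm
  · intro e he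
    rw [← Sym2.card_toFinset_of_not_isDiag e (hP.1 e he)]
    congr 1
    ext v
    simp [Finset.bipartiteBelow]
  · intro v _
    obtain ⟨e, he, hu⟩ := hP.2 v
    rw [Finset.card_eq_one]
    refine ⟨e, ?_⟩
    ext f
    simp only [Finset.bipartiteAbove, Finset.mem_filter, Finset.mem_singleton]
    exact ⟨hu f, fun h => h ▸ he⟩

/-- The graph with edge set the union of two matchings. -/
abbrev unionGraph (p q : V → V) : SimpleGraph V :=
  SimpleGraph.fromEdgeSet (↑(pairEdges p ∪ pairEdges q) : Set (Sym2 V))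

variable {p q : V → V}

theorem unionGraph_adj (hp : ∀ x, p (p x) = x) (hq : ∀ x, q (q x) = x) {x y : V} :
    (unionGraph p q).Adj x y ↔ (p x = y ∨ q x = y) ∧ x ≠ y := by
  simp [unionGraph, mk_mem_pairEdges hp, mk_mem_pairEdges hq, or_and_right]

theorem mem_of_reachable (hp : ∀ x, p (p x) = x) (hq : ∀ x, q (q x) = x) {T : Finset V}
    (hT : ∀ x ∈ T, p x ∈ T ∧ q x ∈ T) {x y : V} (h : (unionGraph p q).Reachable x y)
    (hx : x ∈ T) : y ∈ T := by
  obtain ⟨w⟩ := h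
  induction w with
  | nil => exact hx
  | cons hadj _ ih =>
    rw [unionGraph_adj hp hq] at hadj
    exact ih (by grind)

theorem reachable_apply (hp : ∀ x, p (p x) = x) (hq : ∀ x, q (q x) = x) (x : V) :
    (unionGraph p q).Reachable x (p x) ∧ (unionGraph p q).Reachable x (q x) := by
  constructor
  · by_cases h : x = p x
    · rw [← h]
    · exact ((unionGraph_adj hp hq).2 ⟨.inl rfl, h⟩).reachable
  · by_cases h : x = q x
    · rw [← h]
    · exact ((unionGraph_adj hp hq).2 ⟨.inr rfl, h⟩).reachable

theorem card_connectedComponent_eq_two_iff (hp : ∀ x, p (p x) = x) (hq : ∀ x, q (q x) = x)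
    {a : V} (ha : q a = p a) (hne : (Finset.univ \ {a, p a} : Finset V).Nonempty) :
    Nat.card (unionGraph p q).ConnectedComponent = 2 ↔
      ∀ T ⊆ Finset.univ \ {a, p a}, T.Nonempty → (∀ x ∈ T, p x ∈ T ∧ q x ∈ T) →
        T = Finset.univ \ {a, p a} := by
  classical
  have hpair : ∀ x ∈ ({a, p a} : Finset V), p x ∈ ({a, p a} : Finset V) ∧
      q x ∈ ({a, p a} : Finset V) := by
    have := hp a
    have := hq a
    grind
  constructor
  · intro h T hT ⟨x, hx⟩ hcl
    by_contra hTS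
    obtain ⟨y, hy, hyT⟩ : ∃ y ∈ Finset.univ \ {a, p a}, y ∉ T := by
      by_contra! hcon
      exact hTS (hT.antisymm hcon)
    have hax : (unionGraph p q).connectedComponentMk a ≠
        (unionGraph p q).connectedComponentMk x := fun h => by
      have := mem_of_reachable hp hq hpair (SimpleGraph.ConnectedComponent.eq.1 h) (by simp)
      grind
    have hay : (unionGraph p q).connectedComponentMk a ≠
        (unionGraph p q).connectedComponentMk y := fun h => by
      have := mem_of_reachable hp hq hpair (SimpleGraph.ConnectedComponent.eq.1 h) (by simp)
      grind
    have hxy : (unionGraph p q).connectedComponentMk x ≠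
        (unionGraph p q).connectedComponentMk y := fun h =>
      hyT (mem_of_reachable hp hq hcl (SimpleGraph.ConnectedComponent.eq.1 h) hx)
    have := Set.ncard_eq_three.2 ⟨_, _, _, hax, hay, hxy, rfl⟩
    have := Set.ncard_le_card (α := (unionGraph p q).ConnectedComponent)
      {(unionGraph p q).connectedComponentMk a, (unionGraph p q).connectedComponentMk x,
        (unionGraph p q).connectedComponentMk y}
    lia
  · intro h
    obtain ⟨x, hx⟩ := hne
    have hcomp := h (Finset.univ.filter fun y => (unionGraph p q).Reachable x y) (by
        intro y hy
        by_contra hyS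
        have := mem_of_reachable hp hq hpair (Finset.mem_filter.1 hy).2.symm (by grind)
        grind) ⟨x, by simp⟩ (by
        intro y hy
        have hy := (Finset.mem_filter.1 hy).2
        have := reachable_apply hp hq y
        simpa using ⟨hy.trans this.1, hy.trans this.2⟩)
    rw [Nat.card_eq_two_iff]
    refine ⟨(unionGraph p q).connectedComponentMk a, (unionGraph p q).connectedComponentMk x,
      fun h => ?_, ?_⟩
    · have := mem_of_reachable hp hq hpair (SimpleGraph.ConnectedComponent.eq.1 h) (by simp)
      grind
    · refine Set.eq_univ_of_forall fun C => ?_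
      induction C using SimpleGraph.ConnectedComponent.ind with | _ y
      by_cases hy : y ∈ ({a, p a} : Finset V)
      · left
        rcases Finset.mem_insert.1 hy with rfl | hy
        · rfl
        · rw [Finset.mem_singleton.1 hy]
          exact SimpleGraph.ConnectedComponent.eq.2 (reachable_apply hp hq a).1.symm
      · right
        have : y ∈ Finset.univ.filter fun y => (unionGraph p q).Reachable x y := by
          rw [hcomp]; simpa using hy
        exact SimpleGraph.ConnectedComponent.eq.2 (Finset.mem_filter.1 this).2.symm

end Matching

theorem natCard_isPM_of_mem {n : ℕ} {p : Fin n → Fin n} (hp : ∀ x, p (p x) = x)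
    (hpne : ∀ x, p x ≠ x) (a : Fin n) (hcard : 2 < (Finset.univ \ {a, p a}).card) :
    Nat.card {Q : Finset (Sym2 (Fin n)) // (IsPM Q ∧ (pairEdges p ∩ Q).card = 1 ∧
        Nat.card (SimpleGraph.fromEdgeSet
          (↑(pairEdges p ∪ Q) : Set (Sym2 (Fin n)))).ConnectedComponent = 2) ∧
        s(a, p a) ∈ Q} =
      Nat.card {q // IsTransitiveInvolution p (Finset.univ \ {a, p a}) q} := by
  have hne : (Finset.univ \ {a, p a}).Nonempty := Finset.card_pos.1 (by lia)
  have hclosed : ∀ x ∈ Finset.univ \ {a, p a}, p x ∈ Finset.univ \ {a, p a} := fun x hx => by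
    have := hp x
    have := hp a
    grind
  have hswap : ∀ {q}, IsTransitiveInvolution p (Finset.univ \ {a, p a}) q →
      (∀ x ∈ Finset.univ \ {a, p a}, (Equiv.swap a (p a) ∘ q) x = q x) ∧
        (Equiv.swap a (p a) ∘ q) a = p a ∧ (Equiv.swap a (p a) ∘ q) (p a) = a := fun {q} hq => by
    refine ⟨fun x hx => ?_, by simp [(hq.fixed_iff a).2], by simp [(hq.fixed_iff (p a)).2]⟩
    have := hq.apply_mem hx
    exact Equiv.swap_apply_of_ne_of_ne (by grind) (by grind)
  have hinvol : ∀ {q}, IsTransitiveInvolution p (Finset.univ \ {a, p a}) q →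
      ∀ x, (Equiv.swap a (p a) ∘ q) ((Equiv.swap a (p a) ∘ q) x) = x := fun {q} hq x => by
    obtain ⟨hout, hra, hrb⟩ := hswap hq
    by_cases hx : x ∈ Finset.univ \ {a, p a}
    · rw [hout x hx, hout _ (hq.apply_mem hx), hq.invol]
    · grind
  symm
  refine Nat.card_congr (Equiv.ofBijective (fun q => ⟨pairEdges (Equiv.swap a (p a) ∘ q.1), ?_⟩)
    ⟨?_, ?_⟩)
  · obtain ⟨q, hq⟩ := q
    obtain ⟨hout, hra, hrb⟩ := hswap hq
    have hr := hinvol hq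
    have hrne : ∀ x, (Equiv.swap a (p a) ∘ q) x ≠ x := fun x => by
      by_cases hx : x ∈ Finset.univ \ {a, p a}
      · rw [hout x hx]
        exact fun h => (hq.fixed_iff x).1 h hx
      · have := hpne a
        grind
    refine ⟨⟨isPM_pairEdges hr hrne, Finset.card_eq_one.2 ⟨s(a, p a), ?_⟩,
      (card_connectedComponent_eq_two_iff hp hr hra hne).2 fun T hT hTne hcl =>
        hq.eq_of_closed T hT hTne fun x hx => ?_⟩, (mk_mem_pairEdges hr).2 hra⟩
    · ext e
      induction e with | _ x y
      rw [Finset.mem_inter, mk_mem_pairEdges hp, mk_mem_pairEdges hr, Finset.mem_singleton,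
        Sym2.eq_iff]
      by_cases hx : x ∈ Finset.univ \ {a, p a}
      · have := hq.apply_ne (fun x _ => hp x) hx (hclosed x hx) hcard
        have := hout x hx
        grind
      · have := hp a
        grind
    · have := hcl x hx
      rwa [hout x (hT hx)] at this
  · intro q r hqr
    have hinv : ∀ q : {q // IsTransitiveInvolution p (Finset.univ \ {a, p a}) q},
        ∀ x, (Equiv.swap a (p a) ∘ q.1) ((Equiv.swap a (p a) ∘ q.1) x) = x := fun q => hinvol q.2
    have := pairEdges_injective (hinv q) (hinv r) (Subtype.ext_iff.1 hqr)
    exact Subtype.ext ((Equiv.swap a (p a)).injective.comp_left this)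
  · rintro ⟨Q, ⟨hQ, -, hQc⟩, ha⟩
    obtain ⟨r, hr, hrne, rfl⟩ := hQ.exists_eq_pairEdges
    have hra := (mk_mem_pairEdges hr).1 ha
    have hrb : r (p a) = a := by rw [← hra, hr]
    have hrS : ∀ x ∈ Finset.univ \ {a, p a}, r x ∈ Finset.univ \ {a, p a} := fun x hx => by
      have := hr x
      grind
    have hout : ∀ x ∈ Finset.univ \ {a, p a}, (Equiv.swap a (p a) ∘ r) x = r x := fun x hx => by
      have := hrS x hx
      exact Equiv.swap_apply_of_ne_of_ne (by grind) (by grind)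
    have hqa : (Equiv.swap a (p a) ∘ r) a = a := by simp [hra]
    have hqb : (Equiv.swap a (p a) ∘ r) (p a) = p a := by simp [hrb]
    refine ⟨⟨Equiv.swap a (p a) ∘ r, fun x => ?_, fun x => ?_, fun T hT hTne hcl =>
      (card_connectedComponent_eq_two_iff hp hr hra hne).1 hQc T hT hTne fun x hx => ?_⟩, ?_⟩
    · by_cases hx : x ∈ Finset.univ \ {a, p a}
      · rw [hout x hx, hout _ (hrS x hx), hr]
      · grind
    · by_cases hx : x ∈ Finset.univ \ {a, p a}
      · exact iff_of_false (hout x hx ▸ hrne x) (not_not.2 hx)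
      · grind
    · have := hcl x hx
      rwa [hout x (hT hx)] at this
    · refine Subtype.ext (congrArg pairEdges (funext fun x => ?_))
      simp

/-- Let `k ≥ 3` and let `P` be a perfect matching of `K_{2k}`.  The number of perfect
matchings `Q` of `K_{2k}` sharing exactly one edge with `P` such that the graph on the `2k`
vertices with edge set `P ∪ Q` has exactly two connected components equals `k·(2k-4)!!`. -/
theorem card_one_common_edge_two_components (k : ℕ) (hk : 3 ≤ k)
    (P : Finset (Sym2 (Fin (2 * k)))) (hP : IsPM P) :
    Nat.card {Q : Finset (Sym2 (Fin (2 * k))) // IsPM Q ∧ (P ∩ Q).card = 1 ∧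
        Nat.card
          (SimpleGraph.fromEdgeSet (↑(P ∪ Q) : Set (Sym2 (Fin (2 * k))))).ConnectedComponent
          = 2} =
      k * Nat.doubleFactorial (2 * k - 4) := by
  classical
  have hPcard : P.card = k := by have := hP.two_mul_card; lia
  obtain ⟨p, hp, hpne, rfl⟩ := hP.exists_eq_pairEdges
  have hcount := Finset.sum_card_bipartiteAbove_eq_sum_card_bipartiteBelow
    (s := Finset.univ.filter fun Q : Finset (Sym2 (Fin (2 * k))) =>
      IsPM Q ∧ (pairEdges p ∩ Q).card = 1 ∧ Nat.card (SimpleGraph.fromEdgeSet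
        (↑(pairEdges p ∪ Q) : Set (Sym2 (Fin (2 * k))))).ConnectedComponent = 2)
    (t := pairEdges p) (fun Q e => e ∈ Q)
  rw [Finset.sum_congr rfl (g := fun _ => 1), Finset.sum_congr (s₁ := pairEdges p) rfl
    (g := fun _ => Nat.doubleFactorial (2 * k - 4))] at hcount
  · rw [Nat.card_eq_fintype_card, Fintype.card_subtype]
    simpa [hPcard] using hcount
  · intro e he
    induction e with | _ a b
    obtain rfl := (mk_mem_pairEdges hp).1 he
    have hcard : (Finset.univ \ {a, p a} : Finset (Fin (2 * k))).card = 2 * (k - 2) + 2 := by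
      rw [Finset.card_sdiff_of_subset (Finset.subset_univ _), Finset.card_pair (hpne a).symm,
        Finset.card_univ, Fintype.card_fin]
      lia
    have hfib := natCard_isPM_of_mem hp hpne a (by lia)
    rw [IsTransitiveInvolution.natCard hp (k - 2) _ (fun x hx => ⟨by
      have := hp x
      have := hp a
      grind, hpne x⟩) hcard, Nat.card_eq_fintype_card, Fintype.card_subtype] at hfib
    rw [Finset.bipartiteBelow, Finset.filter_filter, hfib]
    congr 1
    lia
  · intro Q hQ
    have := (Finset.mem_filter.1 hQ).2.2.1
    rwa [← Finset.filter_mem_eq_inter] at this
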